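/- Let U be a normal ultrafilter on a measurable cardinal δ, let κ be a singular cardinal of cofinality δ with the property that μ^δ < κ holds for all cardinals μ < κ, and let λ be a limit ordinal with κ⁺ < λ < j_U(κ) such that cof(λ) = κ⁺ and λ is a regular cardinal in Ult(V,U). If there is a □_κ-sequence, then there is an unbounded subset of λ that is fresh over Ult(V,U). -/

import Mathlib

noncomputable section

open Cardinal Set

namespace MU

/-- The type of ordinals below the initial ordinal of `δ`, serving as the underlying
set of the cardinal `δ` and indexing the ultrapower. -/
abbrev Idx (δ : Cardinal.{0}) : Type 1 := {o : Ordinal.{0} // o < δ.ord}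

/-- A filter `F` is `κ`-complete (equivalently, `<κ`-closed): it is closed under
intersections of fewer than `κ` of its members. -/
def IsCComplete (κ : Cardinal.{0}) {X : Type*} (F : Filter X) : Prop :=
  ∀ (ι : Type) (t : ι → Set X), #ι < κ → (∀ j, t j ∈ F) → (⋂ j, t j) ∈ F

/-- `U` is a normal ultrafilter on the measurable cardinal `δ`: `δ` is uncountable and
`U` is a `δ`-complete nonprincipal ultrafilter on `δ` such that every function that is
regressive on a set in `U` is constant on a set in `U`. -/
structure IsNormalUltrafilter (δ : Cardinal.{0}) (U : Ultrafilter (Idx δ)) : Prop where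
  uncountable : ℵ₀ < δ
  complete : IsCComplete δ (U : Filter (Idx δ))
  nonprincipal : ∀ i : Idx δ, ({i} : Set (Idx δ)) ∉ U
  normal : ∀ f : Idx δ → Ordinal.{0}, { i : Idx δ | f i < i.1 } ∈ U →
    ∃ c : Ordinal.{0}, { i : Idx δ | f i = c } ∈ U

variable {δ : Cardinal.{0}} {U : Ultrafilter (Idx δ)}

/-- The Łoś ordering on representatives of ordinals of the ultrapower `Ult(V,U)`. -/
def ultLT (U : Ultrafilter (Idx δ)) (f g : Idx δ → Ordinal.{0}) : Prop :=
  { i : Idx δ | f i < g i } ∈ U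

theorem ultLT_wf (hU : IsNormalUltrafilter δ U) : WellFounded (ultLT U) := by
  haveI : IsIrrefl (Idx δ → Ordinal.{0}) (ultLT U) := by
    constructor
    intro f hf
    have h : ({ i : Idx δ | f i < f i } : Set (Idx δ)) = ∅ := by ext i; simp
    rw [ultLT, h] at hf
    exact Filter.empty_notMem (U : Filter (Idx δ)) hf
  haveI : IsTrans (Idx δ → Ordinal.{0}) (ultLT U) := by
    constructor
    intro f g h hfg hgh
    have hsub : ({ i : Idx δ | f i < g i } ∩ { i : Idx δ | g i < h i } : Set (Idx δ)) ⊆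
        { i : Idx δ | f i < h i } := fun i hi => show f i < h i from lt_trans hi.1 hi.2
    exact Filter.mem_of_superset (Filter.inter_mem hfg hgh) hsub
  haveI : IsStrictOrder (Idx δ → Ordinal.{0}) (ultLT U) := ⟨⟩
  rw [RelEmbedding.wellFounded_iff_isEmpty]
  constructor
  intro g
  have hmem : ∀ n : ℕ, { i : Idx δ | g (n + 1) i < g n i } ∈ U :=
    fun n => g.map_rel_iff.2 (Nat.lt_succ_self n)
  have hint : (⋂ n : ℕ, { i : Idx δ | g (n + 1) i < g n i }) ∈ U := by
    refine hU.complete ℕ _ ?_ hmem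
    rw [Cardinal.mk_nat]
    exact hU.uncountable
  obtain ⟨i, hi⟩ := Ultrafilter.nonempty_of_mem hint
  have hdesc : ∀ n : ℕ, (fun n => g n i) (n + 1) < (fun n => g n i) n :=
    fun n => Set.mem_iInter.1 hi n
  exact (RelEmbedding.wellFounded_iff_isEmpty.1 Ordinal.lt_wf).false
    (RelEmbedding.natGT (fun n => g n i) hdesc)

/-- The ordinal represented by `f` in the transitive collapse of the ultrapower
`Ult(V,U)`, i.e. the rank of `f` in the (well-founded) Łoś ordering. -/
def ordRank (hU : IsNormalUltrafilter δ U) (f : Idx δ → Ordinal.{0}) : Ordinal.{0} :=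
  sInf { o : Ordinal.{0} | Ordinal.lift.{1} o = ((ultLT_wf hU).apply f).rank }

/-- The image of an ordinal under the ultrapower embedding `j_U : V → Ult(V,U)`. -/
def jU (hU : IsNormalUltrafilter δ U) (o : Ordinal.{0}) : Ordinal.{0} :=
  ordRank hU fun _ => o

/-- The set of ordinals that is the transitive collapse of the element of the
ultrapower `Ult(V,U)` represented by the function `f`. -/
def ultSet (hU : IsNormalUltrafilter δ U) (f : Idx δ → Set Ordinal.{0}) :
    Set Ordinal.{0} :=
  { o : Ordinal.{0} |
    ∃ g : Idx δ → Ordinal.{0}, { i : Idx δ | g i ∈ f i } ∈ U ∧ ordRank hU g = o }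

/-- A set of ordinals is (the transitive collapse of) an element of the ultrapower
`Ult(V,U)`. -/
def InUlt (hU : IsNormalUltrafilter δ U) (A : Set Ordinal.{0}) : Prop :=
  ∃ f : Idx δ → Set Ordinal.{0}, (∀ i, BddAbove (f i)) ∧ A = ultSet hU f

/-- The least upper bound of a set of ordinals. -/
def lub (A : Set Ordinal.{0}) : Ordinal.{0} :=
  sSup ((fun o => o + 1) '' A)

/-- Hamkins: a set `A` of ordinals is fresh over `Ult(V,U)` if `A ∉ Ult(V,U)` but
`A ∩ α ∈ Ult(V,U)` for every `α < lub A`. -/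
def Fresh (hU : IsNormalUltrafilter δ U) (A : Set Ordinal.{0}) : Prop :=
  ¬ InUlt hU A ∧ ∀ α < lub A, InUlt hU (A ∩ Iio α)

/-- `A` is an unbounded subset of the ordinal `l`. -/
def UnbSub (A : Set Ordinal.{0}) (l : Ordinal.{0}) : Prop :=
  A ⊆ Iio l ∧ ∀ b < l, ∃ a ∈ A, b ≤ a

/-- `A` is a closed subset of the ordinal `l`: it contains the suprema of all of its
nonempty subsets that are bounded below `l`. -/
def ClosedIn (A : Set Ordinal.{0}) (l : Ordinal.{0}) : Prop :=
  ∀ S ⊆ A, S.Nonempty → sSup S < l → sSup S ∈ A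

/-- The set of limit points of a set of ordinals. -/
def limitPts (A : Set Ordinal.{0}) : Set Ordinal.{0} :=
  { b : Ordinal.{0} | (A ∩ Iio b).Nonempty ∧ sSup (A ∩ Iio b) = b }

/-- `S` is a stationary subset of the ordinal `l`. -/
def StationaryIn (S : Set Ordinal.{0}) (l : Ordinal.{0}) : Prop :=
  S ⊆ Iio l ∧ ∀ D : Set Ordinal.{0}, ClosedIn D l → UnbSub D l → (S ∩ D).Nonempty

/-- The order type of the set of ordinals `C` is at most `o`. -/
def otpLE (C : Set Ordinal.{0}) (o : Ordinal.{0}) : Prop :=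
  ∃ g : Ordinal.{0} → Ordinal.{0}, (∀ a ∈ C, g a < o) ∧
    ∀ a ∈ C, ∀ b ∈ C, a < b → g a < g b

/-- The order type of the set of ordinals `C` is (strictly) less than `o`. -/
def otpLT (C : Set Ordinal.{0}) (o : Ordinal.{0}) : Prop :=
  ∃ o' < o, otpLE C o'

/-- `C` is a `□(Θ)`-sequence, where `Θ` is (the initial ordinal of) an uncountable
regular cardinal. -/
structure IsSquareSeq (Θ : Ordinal.{0}) (C : Ordinal.{0} → Set Ordinal.{0}) : Prop where
  closed : ∀ γ < Θ, Order.IsSuccLimit γ → ClosedIn (C γ) γ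
  unbounded : ∀ γ < Θ, Order.IsSuccLimit γ → UnbSub (C γ) γ
  coherent : ∀ γ < Θ, Order.IsSuccLimit γ → ∀ β ∈ limitPts (C γ), β < γ → C β = C γ ∩ Iio β
  nontrivial : ¬ ∃ D : Set Ordinal.{0}, ClosedIn D Θ ∧ UnbSub D Θ ∧
    ∀ γ ∈ limitPts D, γ < Θ → D ∩ Iio γ = C γ

/-- `C` is a `□_κ`-sequence: a `□(κ⁺)`-sequence all of whose clubs have order type
at most `κ`. -/
def IsSquareKappaSeq (κ : Cardinal.{0}) (C : Ordinal.{0} → Set Ordinal.{0}) : Prop :=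
  IsSquareSeq (Order.succ κ).ord C ∧
    ∀ γ < (Order.succ κ).ord, Order.IsSuccLimit γ → otpLE (C γ) κ.ord

/-- `κ` is a weakly compact cardinal: `κ` is uncountable and every coloring of the
pairs of ordinals below `κ` in fewer than `κ` colors has a homogeneous set of size `κ`. -/
def IsWeaklyCompact (κ : Cardinal.{0}) : Prop :=
  ℵ₀ < κ ∧ ∀ (ν : Type) (c : Ordinal.{0} → Ordinal.{0} → ν), #ν < κ →
    ∃ H : Set Ordinal.{0}, H ⊆ Iio κ.ord ∧ Cardinal.lift.{1} κ ≤ #H ∧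
      ∀ a ∈ H, ∀ b ∈ H, ∀ a' ∈ H, ∀ b' ∈ H, a < b → a' < b' → c a b = c a' b'

/-- `κ` is a strongly compact cardinal: every `κ`-complete filter (on any set)
extends to a `κ`-complete ultrafilter. -/
def IsStronglyCompact (κ : Cardinal.{0}) : Prop :=
  ∀ (X : Type) (F : Filter X), IsCComplete κ F →
    ∃ G : Ultrafilter X, F ≤ (G : Filter X) ∧ IsCComplete κ (G : Filter X)

/-- `κ` is a singular cardinal. -/
def IsSingular (κ : Cardinal.{0}) : Prop :=
  ℵ₀ ≤ κ ∧ κ.ord.cof < κ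

/-- The cofinality of the ordinal `l` as computed inside the ultrapower `Ult(V,U)`
(as an ordinal, i.e. the image of the ultrapower's cofinality under the transitive
collapse). -/
def cofUlt (hU : IsNormalUltrafilter δ U) (l : Ordinal.{0}) : Ordinal.{0} :=
  sInf { c : Ordinal.{0} | ∃ f : Idx δ → Ordinal.{0},
    ordRank hU f = l ∧ ordRank hU (fun i => ((f i).cof).ord) = c }

/-- The ordinal `o` is (the transitive collapse of) a cardinal of the ultrapower
`Ult(V,U)`. -/
def CardInUlt (hU : IsNormalUltrafilter δ U) (o : Ordinal.{0}) : Prop :=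
  ∃ f : Idx δ → Ordinal.{0}, ordRank hU f = o ∧
    { i : Idx δ | ((f i).card).ord = f i } ∈ U

/-- The ordinal `o` is (the transitive collapse of) a regular cardinal of the
ultrapower `Ult(V,U)`. -/
def RegularInUlt (hU : IsNormalUltrafilter δ U) (o : Ordinal.{0}) : Prop :=
  ∃ f : Idx δ → Ordinal.{0}, ordRank hU f = o ∧
    { i : Idx δ | ((f i).card).IsRegular ∧ ((f i).card).ord = f i } ∈ U

/-- The cardinal successor of the ordinal `o` as computed inside the ultrapower
`Ult(V,U)`: the least ordinal above `o` that is a cardinal in `Ult(V,U)`. -/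
def succInUlt (hU : IsNormalUltrafilter δ U) (o : Ordinal.{0}) : Ordinal.{0} :=
  sInf { c : Ordinal.{0} | o < c ∧ CardInUlt hU c }

/-- The cardinality of a set of ordinals, as an (initial) ordinal: the least ordinal
`o` such that `s` is the image of a function defined on the ordinals below `o`. -/
def setCardOrd (s : Set Ordinal.{0}) : Ordinal.{0} :=
  sInf { o : Ordinal.{0} | ∃ g : Ordinal.{0} → Ordinal.{0}, s ⊆ g '' Iio o }

/-! ### Sets of ordinals -/

theorem mk_le_of_forall_mk_inter_Iio_lt {S : Set Ordinal.{0}} {m : Cardinal.{1}}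
    (h : ∀ x ∈ S, #↥(S ∩ Iio x) < m) : #S ≤ m := by
  rw [← Cardinal.ord_le_ord, ← Ordinal.card_type (α := S) (· < ·)]
  refine (Cardinal.ord_card_le _).trans (le_of_forall_lt fun a ha => ?_)
  obtain ⟨x, rfl⟩ := Ordinal.typein_surj (α := S) (· < ·) ha
  rw [Cardinal.lt_ord, Ordinal.card_typein]
  refine lt_of_le_of_lt ?_ (h x x.2)
  exact Cardinal.mk_le_of_injective (f := fun y : {y : S // y < x} =>
    (⟨y.1.1, y.1.2, y.2⟩ : ↥(S ∩ Iio x.1))) fun y z hyz => by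
      simpa [Subtype.ext_iff] using hyz

theorem mem_limitPts_iff {A : Set Ordinal.{0}} {b : Ordinal.{0}} :
    b ∈ limitPts A ↔ b ≠ 0 ∧ ∀ y < b, ∃ a ∈ A, y < a ∧ a < b := by
  have hbdd : BddAbove (A ∩ Iio b) := ⟨b, fun x hx => le_of_lt hx.2⟩
  constructor
  · rintro ⟨⟨a, ha, hab⟩, hs⟩
    refine ⟨fun h => ?_, fun y hy => ?_⟩
    · subst h; exact absurd (show a < 0 from hab) not_lt_zero
    · rw [← hs] at hy
      obtain ⟨c, hc, hyc⟩ := exists_lt_of_lt_csSup (s := A ∩ Iio b) ⟨a, ha, hab⟩ hy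
      exact ⟨c, hc.1, hyc, hc.2⟩
  · rintro ⟨h0, h⟩
    obtain ⟨a, ha, -, hab⟩ := h 0 (pos_iff_ne_zero.2 h0)
    refine ⟨⟨a, ha, hab⟩, le_antisymm (csSup_le ⟨a, ha, hab⟩ fun x hx => (show x < b from hx.2).le)
      (le_of_forall_lt fun y hy => ?_)⟩
    obtain ⟨c, hc, hyc, hcb⟩ := h y hy
    exact hyc.trans_le (le_csSup hbdd ⟨hc, hcb⟩)

theorem limitPts_limitPts_subset (A : Set Ordinal.{0}) : limitPts (limitPts A) ⊆ limitPts A := by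
  intro b hb
  rw [mem_limitPts_iff] at hb ⊢
  refine ⟨hb.1, fun y hy => ?_⟩
  obtain ⟨c, hc, hyc, hcb⟩ := hb.2 y hy
  obtain ⟨a, ha, hya, hac⟩ := (mem_limitPts_iff.1 hc).2 y hyc
  exact ⟨a, ha, hya, hac.trans hcb⟩

theorem isSuccLimit_of_mem_limitPts {A : Set Ordinal.{0}} {b : Ordinal.{0}}
    (hb : b ∈ limitPts A) : Order.IsSuccLimit b := by
  rw [mem_limitPts_iff] at hb
  refine ⟨fun h => hb.1 (by simpa using h), fun y hy => ?_⟩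
  obtain ⟨a, -, hya, hab⟩ := hb.2 y hy.lt
  exact hy.2 hya hab

theorem mem_limitPts_inter_Iio {A : Set Ordinal.{0}} {b c : Ordinal.{0}} (hbc : b ≤ c) :
    b ∈ limitPts (A ∩ Iio c) ↔ b ∈ limitPts A := by
  simp only [mem_limitPts_iff]
  refine and_congr_right fun _ => forall₂_congr fun y _ => exists_congr fun a => ?_
  constructor
  · rintro ⟨h, h'⟩; exact ⟨h.1, h'⟩
  · rintro ⟨h, h'⟩; exact ⟨⟨h, h'.2.trans_le hbc⟩, h'⟩

theorem limitPts_mono {A B : Set Ordinal.{0}} (h : A ⊆ B) : limitPts A ⊆ limitPts B := by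
  intro b hb
  rw [mem_limitPts_iff] at hb ⊢
  exact ⟨hb.1, fun y hy => let ⟨a, ha, h'⟩ := hb.2 y hy; ⟨a, h ha, h'⟩⟩

/-- A nonempty set of ordinals bounded by `b` attains its supremum, or its supremum is one of its
limit points. -/
theorem sSup_mem_or_mem_limitPts {A : Set Ordinal.{0}} (hA : BddAbove A) (hne : A.Nonempty) :
    sSup A ∈ A ∨ sSup A ∈ limitPts A := by
  by_cases h : sSup A ∈ A
  · exact Or.inl h
  refine Or.inr (mem_limitPts_iff.2 ⟨fun h0 => ?_, fun y hy => ?_⟩)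
  · obtain ⟨a, ha⟩ := hne
    have : a = sSup A := by
      rw [h0]; simpa [h0] using le_csSup hA ha
    exact h (this ▸ ha)
  · obtain ⟨a, ha, hya⟩ := exists_lt_of_lt_csSup hne hy
    exact ⟨a, ha, hya, lt_of_le_of_ne (le_csSup hA ha) fun h' => h (h' ▸ ha)⟩

theorem exists_mem_limitPts_of_infinite {A : Set Ordinal.{0}} (hA : A.Infinite) (b : Ordinal.{0})
    (hb : ∀ a ∈ A, a ≤ b) : ∃ x ∈ limitPts A, x ≤ b := by
  have hex : ∃ x, (A ∩ Iio x).Infinite :=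
    ⟨Order.succ b, by rwa [inter_eq_left.2 (show A ⊆ Iio (Order.succ b) from
      fun a ha => Order.lt_succ_of_le (hb a ha))]⟩
  let x := WellFounded.min Ordinal.lt_wf {x | (A ∩ Iio x).Infinite} hex
  have hx : (A ∩ Iio x).Infinite := WellFounded.min_mem Ordinal.lt_wf _ hex
  have hmin : ∀ y < x, (A ∩ Iio y).Finite := fun y hy => by
    by_contra h
    exact WellFounded.not_lt_min Ordinal.lt_wf {x | (A ∩ Iio x).Infinite} h hy
  have hlim : x ∈ limitPts A := by
    refine mem_limitPts_iff.2 ⟨fun h => ?_, fun y hy => ?_⟩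
    · apply hx
      convert Set.finite_empty
      ext z; simp [h]
    · by_contra! hcon
      refine hx (((hmin y hy).union (Set.finite_singleton y)).subset ?_)
      rintro z ⟨hz, hzx⟩
      rcases lt_trichotomy z y with h | h | h
      · exact Or.inl ⟨hz, h⟩
      · exact Or.inr h
      · exact absurd hzx (not_lt.2 (hcon z hz h))
  refine ⟨x, hlim, ?_⟩
  by_contra! hbx
  obtain ⟨a, ha, hba, -⟩ := (mem_limitPts_iff.1 hlim).2 b hbx
  exact absurd (hb a ha) (not_le.2 hba)

/-! ### A tree-like relation obtained from a coherent ladder system -/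

/-- A coherent system of ladders on the ordinals below `Θ`, with ladders of order type at
most `κ`. -/
structure IsCoherentLadder (κ : Cardinal.{0}) (Θ : Ordinal.{0})
    (D : Ordinal.{0} → Set Ordinal.{0}) : Prop where
  lt : ∀ γ < Θ, ∀ b ∈ D γ, b < γ
  unbounded : ∀ γ < Θ, ∀ a < γ, ∃ b ∈ D γ, a ≤ b
  limit_mem : ∀ γ < Θ, ∀ b ∈ limitPts (D γ), b < γ → b ∈ D γ
  coherent : ∀ γ < Θ, ∀ b ∈ limitPts (D γ), b < γ → D b = D γ ∩ Iio b
  mk_lt : ∀ γ < Θ, ∀ b ∈ D γ, #↥(D γ ∩ Iio b) < Cardinal.lift.{1} κ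

/-- The elements of the ladder `D γ` beyond all of its limit points. -/
def ladderTail (D : Ordinal.{0} → Set Ordinal.{0}) (γ : Ordinal.{0}) : Set Ordinal.{0} :=
  { b | b ∈ D γ ∧ ∀ z ∈ limitPts (D γ), z < γ → z ≤ b }

/-- The part of the ladder `D γ` that is visible at width `m`, relative to a relation `R`. -/
def ladderNode (D : Ordinal.{0} → Set Ordinal.{0}) (m : Cardinal.{1})
    (R : Ordinal.{0} → Ordinal.{0} → Prop) (γ : Ordinal.{0}) : Set Ordinal.{0} :=
  { b | b ∈ D γ ∧ #↥(D γ ∩ Iio b) < m ∧ (b ∈ limitPts (D γ) ∨ b ∈ ladderTail D γ ∧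
    ∀ x ∈ ladderTail D γ, ∀ y ∈ ladderTail D γ, x < y → y ≤ b → R x y) }

/-- The tree relation of width `m` determined by the ladder system `D`. -/
inductive LadderRel (D : Ordinal.{0} → Set Ordinal.{0}) (m : Cardinal.{1}) :
    Ordinal.{0} → Ordinal.{0} → Prop
  | intro {a b γ : Ordinal.{0}} (hb : b ∈ D γ) (hc : #↥(D γ ∩ Iio b) < m)
      (ht : b ∉ limitPts (D γ) → b ∈ ladderTail D γ)
      (hch : b ∉ limitPts (D γ) → ∀ x ∈ ladderTail D γ, ∀ y ∈ ladderTail D γ,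
        x < y → y ≤ b → LadderRel D m x y)
      (ha : a ≠ b → LadderRel D m a b) : LadderRel D m a γ

section LadderRel

variable {κ : Cardinal.{0}} {Θ : Ordinal.{0}} {D : Ordinal.{0} → Set Ordinal.{0}}
  {m : Cardinal.{1}}

theorem ladderRel_iff {a γ : Ordinal.{0}} : LadderRel D m a γ ↔
    ∃ b ∈ ladderNode D m (LadderRel D m) γ, a = b ∨ LadderRel D m a b := by
  constructor
  · rintro ⟨hb, hc, ht, hch, ha⟩
    refine ⟨_, ⟨hb, hc, ?_⟩, or_iff_not_imp_left.2 ha⟩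
    exact or_iff_not_imp_left.2 fun h => ⟨ht h, hch h⟩
  · rintro ⟨b, ⟨hb, hc, h⟩, ha⟩
    exact .intro hb hc (fun hl => (h.resolve_left hl).1) (fun hl => (h.resolve_left hl).2)
      (or_iff_not_imp_left.1 ha)

theorem IsCoherentLadder.lt_of_rel (hD : IsCoherentLadder κ Θ D) {γ : Ordinal.{0}} (hγ : γ < Θ) :
    ∀ {a : Ordinal.{0}}, LadderRel D m a γ → a < γ := by
  induction γ using WellFoundedLT.induction with
  | ind γ ih =>
    intro a ha
    obtain ⟨b, hb, h⟩ := ladderRel_iff.1 ha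
    have hbγ := hD.lt γ hγ b hb.1
    rcases h with rfl | h
    · exact hbγ
    · exact (ih b hbγ (hbγ.trans hγ) h).trans hbγ

theorem IsCoherentLadder.rel_of_mem_limitPts (hD : IsCoherentLadder κ Θ D) {γ b c : Ordinal.{0}}
    (hγ : γ < Θ) (hc : c ∈ limitPts (D γ)) (hcγ : c < γ) (hb : b ∈ limitPts (D γ)) (hbc : b < c)
    (hm : #↥(D γ ∩ Iio b) < m) : LadderRel D m b c := by
  have hDc := hD.coherent γ hγ c hc hcγ
  have hbD := hD.limit_mem γ hγ b hb (hbc.trans hcγ)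
  refine ladderRel_iff.2 ⟨b, ⟨?_, ?_, Or.inl ?_⟩, Or.inl rfl⟩
  · rw [hDc]; exact ⟨hbD, hbc⟩
  · rwa [hDc, inter_assoc, inter_eq_right.2 (Iio_subset_Iio hbc.le)]
  · rwa [hDc, mem_limitPts_inter_Iio hbc.le]

theorem IsCoherentLadder.exists_greatest_limitPt (hD : IsCoherentLadder κ Θ D)
    {γ b z : Ordinal.{0}} (hγ : γ < Θ) (hb : b ∈ ladderTail D γ) (hz : z ∈ limitPts (D γ))
    (hzγ : z < γ) :
    ∃ c, c ∈ limitPts (D γ) ∧ c ≤ b ∧ c < γ ∧ z ≤ c ∧ c ∈ ladderTail D γ := by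
  set L := limitPts (D γ) ∩ Iio γ
  have hLb : ∀ x ∈ L, x ≤ b := fun x hx => hb.2 x hx.1 hx.2
  have hbdd : BddAbove L := ⟨b, hLb⟩
  have hbγ := hD.lt γ hγ b hb.1
  have hcb : sSup L ≤ b := csSup_le ⟨z, hz, hzγ⟩ hLb
  have hc : sSup L ∈ limitPts (D γ) := by
    rcases sSup_mem_or_mem_limitPts hbdd ⟨z, hz, hzγ⟩ with h | h
    · exact h.1
    · exact limitPts_limitPts_subset _ (limitPts_mono inter_subset_left h)
  have hcγ := hcb.trans_lt hbγ
  exact ⟨sSup L, hc, hcb, hcγ, le_csSup hbdd ⟨hz, hzγ⟩, hD.limit_mem γ hγ _ hc hcγ,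
    fun x hx hxγ => le_csSup hbdd ⟨hx, hxγ⟩⟩

theorem IsCoherentLadder.rel_iff_of_rel (hD : IsCoherentLadder κ Θ D) {γ : Ordinal.{0}}
    (hγ : γ < Θ) : ∀ {a b : Ordinal.{0}}, LadderRel D m b γ → a < b →
      (LadderRel D m a γ ↔ LadderRel D m a b) := by
  induction γ using WellFoundedLT.induction with
  | ind γ ih =>
    have hlt : ∀ b ∈ ladderNode D m (LadderRel D m) γ, b < γ := fun b hb => hD.lt γ hγ b hb.1
    have chain : ∀ b ∈ ladderNode D m (LadderRel D m) γ,
        ∀ c ∈ ladderNode D m (LadderRel D m) γ, b < c → LadderRel D m b c := by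
      intro b hb c hc hbc
      by_cases hcl : c ∈ limitPts (D γ)
      · by_cases hbl : b ∈ limitPts (D γ)
        · exact hD.rel_of_mem_limitPts hγ hcl (hlt c hc) hbl hbc hb.2.1
        · exact absurd ((hb.2.2.resolve_left hbl).1.2 c hcl (hlt c hc)) (not_le.2 hbc)
      · obtain ⟨hct, hch⟩ := hc.2.2.resolve_left hcl
        rcases hb.2.2 with hbl | hbt
        · obtain ⟨d, hd, hdc, hdγ, hbd, hdt⟩ :=
            hD.exists_greatest_limitPt hγ hct hbl (hlt b hb)
          have hdc' : d < c := lt_of_le_of_ne hdc fun h => hcl (h ▸ hd)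
          have hR := hch d hdt c hct hdc' le_rfl
          rcases hbd.eq_or_lt with rfl | hbd
          · exact hR
          · exact (ih c (hlt c hc) ((hlt c hc).trans hγ) hR hbd).2
              (hD.rel_of_mem_limitPts hγ hd hdγ hbl hbd hb.2.1)
        · exact hch b hbt.1 c hct hbc le_rfl
    have node : ∀ b ∈ ladderNode D m (LadderRel D m) γ, ∀ a < b,
        (LadderRel D m a γ ↔ LadderRel D m a b) := by
      intro b hb a hab
      refine ⟨fun h => ?_, fun h => ladderRel_iff.2 ⟨b, hb, Or.inr h⟩⟩
      obtain ⟨c, hc, hac⟩ := ladderRel_iff.1 h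
      rcases lt_trichotomy c b with hcb | rfl | hcb
      · have hR := chain c hc b hb hcb
        rcases hac with rfl | hac
        · exact hR
        · exact (ih b (hlt b hb) ((hlt b hb).trans hγ) hR
            (hD.lt_of_rel ((hlt c hc).trans hγ) hac)).2 hac
      · exact hac.resolve_left hab.ne
      · exact (ih c (hlt c hc) ((hlt c hc).trans hγ) (chain b hb c hc hcb) hab).1
          (hac.resolve_left (hab.trans hcb).ne)
    intro a b hb hab
    obtain ⟨c, hc, rfl | hbc⟩ := ladderRel_iff.1 hb
    · exact node _ hc a hab
    · rw [node c hc a (hab.trans (hD.lt_of_rel ((hlt c hc).trans hγ) hbc))]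
      exact ih c (hlt c hc) ((hlt c hc).trans hγ) hbc hab

theorem IsCoherentLadder.mk_setOf_rel_le (hD : IsCoherentLadder κ Θ D) (hm : ℵ₀ ≤ m)
    {γ : Ordinal.{0}} (hγ : γ < Θ) : #{a | LadderRel D m a γ} ≤ m := by
  induction γ using WellFoundedLT.induction with
  | ind γ ih =>
    set N := ladderNode D m (LadderRel D m) γ
    have hN : #N ≤ m := mk_le_of_forall_mk_inter_Iio_lt fun b hb =>
      (Cardinal.mk_le_mk_of_subset (inter_subset_inter_left _ fun x hx => hx.1)).trans_lt hb.2.1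
    have hsub : {a | LadderRel D m a γ} ⊆ ⋃ b : N, insert b.1 {a | LadderRel D m a b} := by
      intro a ha
      obtain ⟨b, hb, h⟩ := ladderRel_iff.1 ha
      exact mem_iUnion.2 ⟨⟨b, hb⟩, h⟩
    refine (Cardinal.mk_le_mk_of_subset hsub).trans ((Cardinal.mk_iUnion_le _).trans ?_)
    refine (mul_le_mul' hN (ciSup_le' fun b => ?_)).trans (Cardinal.mul_eq_self hm).le
    have hbγ := hD.lt γ hγ b b.2.1
    exact Cardinal.mk_insert_le.trans (Cardinal.add_le_of_le hm (ih b hbγ (hbγ.trans hγ))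
      (Cardinal.one_le_aleph0.trans hm))

theorem IsCoherentLadder.eventually_rel (hD : IsCoherentLadder κ Θ D) {I : Type*} {L : Filter I}
    {w : I → Cardinal.{1}} (hw : ∀ ν < Cardinal.lift.{1} κ, ∀ᶠ i in L, ν < w i)
    {γ : Ordinal.{0}} (hγ : γ < Θ) :
    ∀ {a : Ordinal.{0}}, a < γ → ∀ᶠ i in L, LadderRel D (w i) a γ := by
  induction γ using WellFoundedLT.induction with
  | ind γ ih =>
    intro a ha
    suffices h : ∃ b ∈ D γ, a ≤ b ∧
        ∀ᶠ i in L, b ∈ ladderNode D (w i) (LadderRel D (w i)) γ by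
      obtain ⟨b, hb, hab, hev⟩ := h
      have hbγ := hD.lt γ hγ b hb
      rcases hab.eq_or_lt with rfl | hab
      · exact hev.mono fun i hi => ladderRel_iff.2 ⟨_, hi, Or.inl rfl⟩
      · filter_upwards [hev, ih b hbγ (hbγ.trans hγ) hab] with i hi hi'
        exact ladderRel_iff.2 ⟨b, hi, Or.inr hi'⟩
    obtain ⟨b, hb, hab⟩ := hD.unbounded γ hγ a ha
    by_cases hT : b ∈ ladderTail D γ
    · refine ⟨b, hb, hab, ?_⟩
      have hbγ := hD.lt γ hγ b hb
      have hfin : (ladderTail D γ ∩ Iic b).Finite := by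
        by_contra hinf
        obtain ⟨x, hx, hxb⟩ := exists_mem_limitPts_of_infinite hinf b fun y hy => hy.2
        obtain ⟨y, hy, -, hyx⟩ := (mem_limitPts_iff.1 hx).2 0
          (pos_iff_ne_zero.2 (mem_limitPts_iff.1 hx).1)
        exact absurd (hy.1.2 x (limitPts_mono (fun z hz => hz.1.1) hx) (hxb.trans_lt hbγ))
          (not_le.2 hyx)
      have hall : ∀ᶠ i in L, ∀ x ∈ ladderTail D γ ∩ Iic b, ∀ y ∈ ladderTail D γ ∩ Iic b,
          x < y → LadderRel D (w i) x y := by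
        refine (Filter.eventually_all_finite hfin).2 fun x _ =>
          (Filter.eventually_all_finite hfin).2 fun y hy => ?_
        by_cases hxy : x < y
        · have hyγ := hD.lt γ hγ y hy.1.1
          exact (ih y hyγ (hyγ.trans hγ) hxy).mono fun i hi _ => hi
        · exact Filter.Eventually.of_forall fun i h => absurd h hxy
      filter_upwards [hall, hw _ (hD.mk_lt γ hγ b hb)] with i hi hi'
      exact ⟨hb, hi', Or.inr ⟨hT, fun x hx y hy hxy hyb =>
        hi x ⟨hx, hxy.le.trans hyb⟩ y ⟨hy, hyb⟩ hxy⟩⟩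
    · have : ∃ z ∈ limitPts (D γ), z < γ ∧ b < z := by
        by_contra! hcon
        exact hT ⟨hb, hcon⟩
      obtain ⟨z, hz, hzγ, hbz⟩ := this
      have hzD := hD.limit_mem γ hγ z hz hzγ
      exact ⟨z, hzD, hab.trans hbz.le,
        (hw _ (hD.mk_lt γ hγ z hzD)).mono fun i hi => ⟨hzD, hi, Or.inl hz⟩⟩

end LadderRel

/-- The coherent ladder system given by a square sequence, completed at successor ordinals. -/
def squareLadder (C : Ordinal.{0} → Set Ordinal.{0}) (γ : Ordinal.{0}) : Set Ordinal.{0} :=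
  { b | (Order.IsSuccLimit γ ∧ b ∈ C γ) ∨ (¬ Order.IsSuccLimit γ ∧ Order.succ b = γ) }

theorem squareLadder_of_isSuccLimit {C : Ordinal.{0} → Set Ordinal.{0}} {γ : Ordinal.{0}}
    (hγ : Order.IsSuccLimit γ) : squareLadder C γ = C γ := by
  ext b
  simp only [squareLadder, mem_ofPred_eq, hγ, true_and, not_true, false_and, or_false]

theorem mem_squareLadder_of_not_isSuccLimit {C : Ordinal.{0} → Set Ordinal.{0}}
    {γ b : Ordinal.{0}} (hγ : ¬ Order.IsSuccLimit γ) :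
    b ∈ squareLadder C γ ↔ Order.succ b = γ := by
  simp only [squareLadder, mem_ofPred_eq, hγ, not_false_eq_true, true_and, false_and, false_or]

theorem IsSquareKappaSeq.isCoherentLadder {κ : Cardinal.{0}} (hκ : ℵ₀ ≤ κ)
    {C : Ordinal.{0} → Set Ordinal.{0}} (hC : IsSquareKappaSeq κ C) :
    IsCoherentLadder κ (Order.succ κ).ord (squareLadder C) := by
  have hlim : ∀ γ, ¬ Order.IsSuccLimit γ → ∀ b ∈ limitPts (squareLadder C γ), ¬ b < γ := by
    intro γ hγ b hb hbγ
    obtain ⟨a, ha, -, hab⟩ := (mem_limitPts_iff.1 hb).2 0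
      (pos_iff_ne_zero.2 (mem_limitPts_iff.1 hb).1)
    rw [mem_squareLadder_of_not_isSuccLimit hγ] at ha
    exact absurd (Order.succ_le_of_lt hab) (not_le.2 (ha ▸ hbγ))
  refine ⟨fun γ hγ b hb => ?_, fun γ hγ a ha => ?_, fun γ hγ b hb hbγ => ?_,
    fun γ hγ b hb hbγ => ?_, fun γ hγ b hb => ?_⟩ <;> by_cases hl : Order.IsSuccLimit γ
  · rw [squareLadder_of_isSuccLimit hl] at hb
    exact (hC.1.unbounded γ hγ hl).1 hb
  · rw [mem_squareLadder_of_not_isSuccLimit hl] at hb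
    exact hb ▸ Order.lt_succ b
  · rw [squareLadder_of_isSuccLimit hl]
    exact (hC.1.unbounded γ hγ hl).2 a ha
  · have : ∃ b, Order.succ b = γ := by
      by_contra! hcon
      refine hl ⟨fun h => absurd ha (by simp [h.eq_bot]), fun y hy => ?_⟩
      exact hcon y hy.succ_eq
    obtain ⟨b, rfl⟩ := this
    exact ⟨b, (mem_squareLadder_of_not_isSuccLimit hl).2 rfl, Order.lt_succ_iff.1 ha⟩
  · rw [squareLadder_of_isSuccLimit hl] at hb ⊢
    have := hC.1.closed γ hγ hl (C γ ∩ Iio b) inter_subset_left hb.1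
    rw [hb.2] at this
    exact this hbγ
  · exact absurd hbγ (hlim γ hl b hb)
  · rw [squareLadder_of_isSuccLimit hl] at hb ⊢
    rw [squareLadder_of_isSuccLimit (isSuccLimit_of_mem_limitPts hb)]
    exact hC.1.coherent γ hγ hl b hb hbγ
  · exact absurd hbγ (hlim γ hl b hb)
  · rw [squareLadder_of_isSuccLimit hl] at hb ⊢
    obtain ⟨g, hg, hmono⟩ := hC.2 γ hγ hl
    have hinj : StrictMonoOn g (C γ) := fun x hx y hy hxy => hmono x hx y hy hxy
    have hmaps : MapsTo g (C γ ∩ Iio b) (Iio (g b)) := fun x hx => hmono x hx.1 b hb hx.2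
    have hle := Cardinal.mk_le_of_injective
      (hmaps.restrict_inj.2 (hinj.injOn.mono inter_subset_left))
    refine hle.trans_lt ?_
    rw [Cardinal.mk_Iio_ordinal, Cardinal.lift_lt, ← Cardinal.lt_ord]
    exact hg b hb
  · have hempty : squareLadder C γ ∩ Iio b = ∅ := by
      rw [eq_empty_iff_forall_notMem]
      rintro x ⟨hx, hxb⟩
      rw [mem_squareLadder_of_not_isSuccLimit hl] at hx hb
      exact absurd hxb (Order.succ_injective (hx.trans hb.symm)).not_lt
    rw [hempty, Cardinal.mk_eq_zero]
    exact Cardinal.aleph0_pos.trans_le (Cardinal.aleph0_le_lift.2 hκ)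

/-! ### Ordinals of the ultrapower -/

instance small_idx : Small.{0} (Idx δ) := inferInstanceAs (Small.{0} (Iio δ.ord))

theorem mk_idx (δ : Cardinal.{0}) : #(Idx δ) = Cardinal.lift.{1} δ := by
  rw [← Cardinal.card_ord δ, ← Cardinal.mk_Iio_ordinal, Cardinal.card_ord]
  rfl

section Ultrapower

variable (hU : IsNormalUltrafilter δ U)

theorem ultLT_iff_eventually {f g : Idx δ → Ordinal.{0}} :
    ultLT U f g ↔ ∀ᶠ i in (U : Filter (Idx δ)), f i < g i := Iff.rfl

theorem rank_ultLT_le {f g : Idx δ → Ordinal.{0}} (h : ∀ᶠ i in (U : Filter (Idx δ)), f i ≤ g i) :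
    ((ultLT_wf hU).apply f).rank ≤ ((ultLT_wf hU).apply g).rank := by
  rw [Acc.rank_eq]
  refine Ordinal.iSup_le fun b => Order.succ_le_of_lt ?_
  refine Acc.rank_lt_of_rel ((ultLT_wf hU).apply g) (ultLT_iff_eventually.2 ?_)
  filter_upwards [h, ultLT_iff_eventually.1 b.2] with i h1 h2 using h2.trans_le h1

theorem eventually_lt_of_rank_lt {f g : Idx δ → Ordinal.{0}}
    (h : ((ultLT_wf hU).apply f).rank < ((ultLT_wf hU).apply g).rank) :
    ∀ᶠ i in (U : Filter (Idx δ)), f i < g i := by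
  by_contra hcon
  rw [← Ultrafilter.eventually_not] at hcon
  exact absurd h (not_lt.2 (rank_ultLT_le hU (hcon.mono fun i hi => not_lt.1 hi)))

theorem exists_lift_eq_rank (f : Idx δ → Ordinal.{0}) :
    ∃ o : Ordinal.{0}, Ordinal.lift.{1} o = ((ultLT_wf hU).apply f).rank := by
  set r := ((ultLT_wf hU).apply f).rank with hr
  let P := (i : Idx δ) → Iio (f i + 1)
  have hsm : Small.{0} P := inferInstance
  have hex : ∀ o : Iio r, ∃ p : P, ((ultLT_wf hU).apply fun i => (p i : Ordinal.{0})).rank = o := by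
    rintro ⟨o, ho⟩
    obtain ⟨g, hg, rfl⟩ := Acc.mem_range_rank_of_le _ (le_of_lt ho)
    have hgf := eventually_lt_of_rank_lt hU ho
    refine ⟨fun i => ⟨min (g i) (f i),
      show min (g i) (f i) < f i + 1 from Order.lt_add_one_iff.2 (min_le_right _ _)⟩, ?_⟩
    refine le_antisymm (rank_ultLT_le hU (.of_forall fun i => min_le_left _ _))
      (rank_ultLT_le hU (hgf.mono fun i hi => (min_eq_left hi.le).ge))
  choose p hp using hex
  have hinj : Function.Injective p := fun x y hxy => Subtype.ext (by rw [← hp x, ← hp y, hxy])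
  have hle := Cardinal.lift_mk_le_lift_mk_of_injective
    ((equivShrink.{0} P).injective.comp hinj)
  rw [Cardinal.mk_Iio_ordinal, Cardinal.lift_id', ← Cardinal.lift_lift.{1, 2, 0},
    Cardinal.lift_le] at hle
  exact Ordinal.mem_range_lift_of_card_le hle

theorem lift_ordRank (f : Idx δ → Ordinal.{0}) :
    Ordinal.lift.{1} (ordRank hU f) = ((ultLT_wf hU).apply f).rank :=
  csInf_mem (exists_lift_eq_rank hU f)

theorem ordRank_lt_iff {f g : Idx δ → Ordinal.{0}} :
    ordRank hU f < ordRank hU g ↔ ∀ᶠ i in (U : Filter (Idx δ)), f i < g i := by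
  rw [← Ordinal.lift_lt.{1, 0}, lift_ordRank, lift_ordRank]
  exact ⟨eventually_lt_of_rank_lt hU, fun h => Acc.rank_lt_of_rel ((ultLT_wf hU).apply g) h⟩

theorem ordRank_le_iff {f g : Idx δ → Ordinal.{0}} :
    ordRank hU f ≤ ordRank hU g ↔ ∀ᶠ i in (U : Filter (Idx δ)), f i ≤ g i := by
  rw [← not_lt, ordRank_lt_iff, ← Ultrafilter.eventually_not]
  simp only [not_lt]

theorem ordRank_eq_iff {f g : Idx δ → Ordinal.{0}} :
    ordRank hU f = ordRank hU g ↔ ∀ᶠ i in (U : Filter (Idx δ)), f i = g i := by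
  rw [le_antisymm_iff, ordRank_le_iff, ordRank_le_iff, ← Filter.eventually_and]
  simp only [le_antisymm_iff]

theorem exists_ordRank_eq {o : Ordinal.{0}} {f : Idx δ → Ordinal.{0}} (h : o < ordRank hU f) :
    ∃ g : Idx δ → Ordinal.{0}, ordRank hU g = o := by
  rw [← Ordinal.lift_lt.{1, 0}, lift_ordRank] at h
  obtain ⟨g, hg, hgo⟩ := Acc.mem_range_rank_of_le _ h.le
  exact ⟨g, Ordinal.lift_inj.1 ((lift_ordRank hU g).trans hgo)⟩

theorem ordRank_mem_ultSet_iff {f : Idx δ → Set Ordinal.{0}} {g : Idx δ → Ordinal.{0}} :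
    ordRank hU g ∈ ultSet hU f ↔ ∀ᶠ i in (U : Filter (Idx δ)), g i ∈ f i := by
  constructor
  · rintro ⟨h, hh, he⟩
    filter_upwards [(ordRank_eq_iff hU).1 he, hh] with i h1 h2
    rw [← h1]; exact h2
  · exact fun h => ⟨g, h, rfl⟩

end Ultrapower

section Width

variable {κ : Cardinal.{0}}

theorem IsNormalUltrafilter.eventually_gt (hU : IsNormalUltrafilter δ U) (j : Idx δ) :
    ∀ᶠ i in (U : Filter (Idx δ)), j < i := by
  have hcard : #(Shrink.{0} (Iic j)) < δ := by
    have hle := Cardinal.mk_le_of_injective (β := Iio (j.1 + 1))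
      (f := fun x : Iic j => ⟨x.1.1, show x.1.1 < j.1 + 1 from Order.lt_add_one_iff.2 x.2⟩)
      fun x y hxy => Subtype.ext (Subtype.ext (congrArg (fun z => z.1) hxy))
    rw [Cardinal.mk_Iio_ordinal, ← Cardinal.lift_mk_shrink'', Cardinal.lift_le] at hle
    refine hle.trans_lt (Cardinal.lt_ord.1 ?_)
    exact (Cardinal.isSuccLimit_ord hU.uncountable.le).add_one_lt j.2
  have := hU.complete (Shrink.{0} (Iic j)) (fun s => {((equivShrink.{0} (Iic j)).symm s).1}ᶜ)
    hcard fun s => Ultrafilter.compl_mem_iff_notMem.2 (hU.nonprincipal _)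
  filter_upwards [this] with i hi
  by_contra hij
  refine mem_iInter.1 hi (equivShrink.{0} _ ⟨i, not_lt.1 hij⟩) ?_
  simp

theorem IsNormalUltrafilter.exists_eventually_eq (hU : IsNormalUltrafilter δ U)
    (f : Idx δ → Idx δ) (hf : ∀ᶠ i in (U : Filter (Idx δ)), f i < i) :
    ∃ j, ∀ᶠ i in (U : Filter (Idx δ)), f i = j := by
  obtain ⟨c, hc⟩ := hU.normal (fun i => (f i).1) hf
  obtain ⟨i, hi⟩ := Ultrafilter.nonempty_of_mem hc
  refine ⟨f i, Filter.mem_of_superset hc fun x hx => ?_⟩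
  exact Subtype.ext (Eq.trans (show (f x).1 = c from hx) (Eq.symm hi))

theorem IsNormalUltrafilter.card_ordRank_le (hU : IsNormalUltrafilter δ U) (hδ : δ ≤ κ)
    (hexp : ∀ μ < κ, μ ^ δ < κ) {c : Idx δ → Ordinal.{0}} (hc : ∀ i, c i < κ.ord)
    {h : Idx δ → Ordinal.{0}}
    (hh : ∀ᶠ i in (U : Filter (Idx δ)), (h i).card ≤ (⨆ j : Iio i, c j).card) :
    (ordRank hU h).card ≤ κ := by
  have hκ : ℵ₀ ≤ κ := hU.uncountable.le.trans hδ
  have hinj : ∀ i, ∃ e : Ordinal.{0} → Ordinal.{0}, (h i).card ≤ (⨆ j : Iio i, c j).card →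
      MapsTo e (Iio (h i)) (Iio (⨆ j : Iio i, c j)) ∧ InjOn e (Iio (h i)) := by
    intro i
    by_cases hi : (h i).card ≤ (⨆ j : Iio i, c j).card
    · rw [← Cardinal.lift_le.{1}, ← Cardinal.mk_Iio_ordinal, ← Cardinal.mk_Iio_ordinal] at hi
      obtain ⟨e⟩ := hi
      refine ⟨fun x => if hx : x ∈ Iio (h i) then e ⟨x, hx⟩ else 0, fun _ => ⟨?_, ?_⟩⟩
      · intro x hx
        simp only [dif_pos hx]
        exact (e ⟨x, hx⟩).2
      · intro x hx y hy hxy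
        simp only [dif_pos hx, dif_pos hy] at hxy
        exact congrArg Subtype.val (e.injective (Subtype.ext hxy))
    · exact ⟨id, fun hi' => absurd hi' hi⟩
  choose e he using hinj
  have hrep : ∀ o : Iio (ordRank hU h), ∃ g : Idx δ → Ordinal.{0}, ordRank hU g = o :=
    fun o => exists_ordRank_eq hU o.2
  choose g hg using hrep
  have hgh : ∀ o, ∀ᶠ i in (U : Filter (Idx δ)), g o i < h i := fun o =>
    (ordRank_lt_iff hU).1 ((hg o).trans_lt o.2)
  let S : Idx δ → Set (Iio (ordRank hU h)) := fun j =>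
    { o | ∀ᶠ i in (U : Filter (Idx δ)), e i (g o i) < c j }
  have hS : ⋃ j, S j = Set.univ := by
    refine eq_univ_of_forall fun o => mem_iUnion.2 ?_
    have hex : ∀ i, ∃ j : Idx δ, e i (g o i) < (⨆ j : Iio i, c j) →
        j < i ∧ e i (g o i) < c j := by
      intro i
      by_cases hi : e i (g o i) < (⨆ j : Iio i, c j)
      · obtain ⟨j, hj⟩ := Ordinal.lt_iSup_iff.1 hi
        exact ⟨j, fun _ => ⟨j.2, hj⟩⟩
      · exact ⟨i, fun hi' => absurd hi' hi⟩
    choose t ht using hex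
    have hev : ∀ᶠ i in (U : Filter (Idx δ)), t i < i ∧ e i (g o i) < c (t i) := by
      filter_upwards [hh, hgh o] with i h1 h2 using ht i ((he i h1).1 h2)
    obtain ⟨j, hj⟩ := hU.exists_eventually_eq t (hev.mono fun i hi => hi.1)
    exact ⟨j, by filter_upwards [hj, hev] with i h1 h2 using h1 ▸ h2.2⟩
  have hSle : ∀ j, #(S j) ≤ Cardinal.lift.{1} κ := by
    intro j
    rcases (S j).eq_empty_or_nonempty with hj | ⟨o, ho⟩
    · rw [hj, Cardinal.mk_eq_zero]
      exact zero_le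
    obtain ⟨i, hi⟩ := Filter.Eventually.exists (f := (U : Filter (Idx δ))) ho
    have hpos : 0 < c j := (zero_le).trans_lt hi
    have hle := Cardinal.mk_le_of_injective (α := S j) (β := Idx δ → Iio (c j))
      (f := fun o i => if hi : e i (g o i) < c j then ⟨_, hi⟩ else ⟨0, hpos⟩) (by
        intro o o' hoo
        refine Subtype.ext (Subtype.ext ?_)
        rw [← hg o, ← hg o', ordRank_eq_iff]
        filter_upwards [hh, hgh o, hgh o', o.2, o'.2] with i h1 h2 h3 h4 h5
        have := congrFun hoo i
        simp only [dif_pos h4, dif_pos h5] at this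
        exact (he i h1).2 h2 h3 (congrArg Subtype.val this))
    refine hle.trans ?_
    rw [← Cardinal.power_def, Cardinal.mk_Iio_ordinal,
      mk_idx, ← Cardinal.lift_power, Cardinal.lift_le]
    exact (hexp _ (Cardinal.lt_ord.1 (hc j))).le
  rw [← Cardinal.lift_le.{1}, ← Cardinal.mk_Iio_ordinal, ← Cardinal.mk_univ, ← hS]
  refine (Cardinal.mk_iUnion_le _).trans (Cardinal.mul_le_of_le (Cardinal.aleph0_le_lift.2 hκ) ?_
    (ciSup_le' hSle))
  rw [mk_idx, Cardinal.lift_le]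
  exact hδ

theorem IsSingular.succ_lt (hκ : IsSingular κ) {ν : Cardinal.{0}} (hν : ν < κ) :
    Order.succ ν < κ := by
  refine (Order.succ_le_of_lt hν).lt_of_ne fun h => ?_
  rcases lt_or_ge ν ℵ₀ with hfin | hinf
  · exact absurd (h ▸ hκ.1) (not_le.2 (Cardinal.isSuccLimit_aleph0.succ_lt hfin))
  · exact absurd (h ▸ hκ.2) (not_lt.2 (Cardinal.isRegular_succ hinf).2)

/-- A sequence of cardinals cofinal in `κ` whose successors represent an ordinal at most `κ⁺`. -/
theorem IsNormalUltrafilter.exists_width (hU : IsNormalUltrafilter δ U) (hsing : IsSingular κ)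
    (hcof : κ.ord.cof = δ) (hexp : ∀ μ < κ, μ ^ δ < κ) :
    ∃ m : Idx δ → Cardinal.{0}, (∀ ν < κ, ∀ᶠ i in (U : Filter (Idx δ)), ν < m i) ∧
      ∀ h : Idx δ → Ordinal.{0},
        (∀ᶠ i in (U : Filter (Idx δ)), h i < (Order.succ (m i)).ord) →
          ordRank hU h < (Order.succ κ).ord := by
  obtain ⟨c, hc⟩ := Ordinal.exists_isFundamentalSeq (congrArg Cardinal.ord hcof)
  refine ⟨fun i => (⨆ j : Iio i, (c j.1 : Ordinal.{0})).card, fun ν hν => ?_, fun h hh => ?_⟩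
  · obtain ⟨_, ⟨j, rfl⟩, hj⟩ :=
      hc.isCofinal_range ⟨(Order.succ ν).ord, Cardinal.ord_lt_ord.2 (hsing.succ_lt hν)⟩
    filter_upwards [hU.eventually_gt j] with i hi
    rw [← Order.succ_le_iff, ← Cardinal.ord_le]
    exact le_trans hj (Ordinal.le_iSup (fun j : Iio i => (c j.1 : Ordinal.{0})) ⟨j, hi⟩)
  · rw [Cardinal.lt_ord, Order.lt_succ_iff]
    refine hU.card_ordRank_le (hcof ▸ hsing.2.le) hexp (c := fun j => c j) (fun i => (c i).2) ?_
    filter_upwards [hh] with i hi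
    exact Order.lt_succ_iff.1 (Cardinal.lt_ord.1 hi)

end Width

section Height

variable {κ : Cardinal.{0}} {Θ : Ordinal.{0}} {D : Ordinal.{0} → Set Ordinal.{0}}
  {m : Cardinal.{1}}

/-- The least function above `base` that is strictly increasing along `LadderRel D m`. -/
def ladderHeight (D : Ordinal.{0} → Set Ordinal.{0}) (m : Cardinal.{1})
    (base : Ordinal.{0} → Ordinal.{0}) (γ : Ordinal.{0}) : Ordinal.{0} :=
  max (base γ) (⨆ β : { β // β < γ ∧ LadderRel D m β γ }, ladderHeight D m base β.1 + 1)
termination_by γ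
decreasing_by exact β.2.1

theorem base_le_ladderHeight (base : Ordinal.{0} → Ordinal.{0}) (γ : Ordinal.{0}) :
    base γ ≤ ladderHeight D m base γ := by
  rw [ladderHeight]
  exact le_max_left _ _

theorem ladderHeight_lt_ladderHeight (base : Ordinal.{0} → Ordinal.{0}) {β γ : Ordinal.{0}}
    (hβγ : β < γ) (h : LadderRel D m β γ) :
    ladderHeight D m base β < ladderHeight D m base γ := by
  have : Small.{0} { β // β < γ ∧ LadderRel D m β γ } :=
    small_of_injective (β := Iio γ) (f := fun x => ⟨x.1, x.2.1⟩)
      fun x y hxy => Subtype.ext (congrArg (fun z : Iio γ => z.1) hxy)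
  rw [ladderHeight.eq_1 D m base γ, ← Order.add_one_le_iff]
  exact le_max_of_le_right (Ordinal.le_iSup
    (fun β : { β // β < γ ∧ LadderRel D m β γ } => ladderHeight D m base β.1 + 1) ⟨β, hβγ, h⟩)

theorem IsCoherentLadder.ladderHeight_lt (hD : IsCoherentLadder κ Θ D) (hm : ℵ₀ ≤ m)
    {base : Ordinal.{0} → Ordinal.{0}} {a : Ordinal.{0}} (ha : m < (Ordinal.lift.{1} a).cof)
    (hbase : ∀ γ < Θ, base γ < a) {γ : Ordinal.{0}} (hγ : γ < Θ) :
    ladderHeight D m base γ < a := by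
  induction γ using WellFoundedLT.induction with
  | ind γ ih =>
    rw [ladderHeight]
    refine max_lt (hbase γ hγ) (Ordinal.lift_iSup_add_one_lt_of_lt_cof ?_
      fun β => ih β.1 β.2.1 (β.2.1.trans hγ))
    rw [Cardinal.lift_id'.{0, 1}]
    exact ((Cardinal.mk_subtype_mono fun β h => h.2).trans (hD.mk_setOf_rel_le hm hγ)).trans_lt ha

end Height

section Fresh

variable {κ : Cardinal.{0}} {Θ : Ordinal.{0}} {D : Ordinal.{0} → Set Ordinal.{0}}
  {w : Idx δ → Cardinal.{1}} {G : Idx δ → Ordinal.{0} → Ordinal.{0}}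

/-- The set of ordinals of the ultrapower represented by the heights of the predecessors of `γ`. -/
def traceSet (hU : IsNormalUltrafilter δ U) (D : Ordinal.{0} → Set Ordinal.{0})
    (w : Idx δ → Cardinal.{1}) (G : Idx δ → Ordinal.{0} → Ordinal.{0}) (γ : Ordinal.{0}) :
    Set Ordinal.{0} :=
  ultSet hU fun i => G i '' { β | LadderRel D (w i) β γ }

variable (hU : IsNormalUltrafilter δ U)

theorem ordRank_mem_traceSet_iff {γ : Ordinal.{0}} {g : Idx δ → Ordinal.{0}} :
    ordRank hU g ∈ traceSet hU D w G γ ↔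
      ∀ᶠ i in (U : Filter (Idx δ)), ∃ β, LadderRel D (w i) β γ ∧ G i β = g i :=
  ordRank_mem_ultSet_iff hU

theorem exists_of_mem_traceSet {γ o : Ordinal.{0}} (h : o ∈ traceSet hU D w G γ) :
    ∃ g : Idx δ → Ordinal.{0}, ordRank hU g = o :=
  let ⟨g, _, hg⟩ := h
  ⟨g, hg⟩

/-- The functions `G i` increase along ladder relations of widths `w i`, and these relations
exhaust the order below `Θ` modulo `U`. -/
structure IsLadderHeights (U : Ultrafilter (Idx δ)) (κ : Cardinal.{0}) (Θ : Ordinal.{0})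
    (D : Ordinal.{0} → Set Ordinal.{0}) (w : Idx δ → Cardinal.{1})
    (G : Idx δ → Ordinal.{0} → Ordinal.{0}) : Prop where
  ladder : IsCoherentLadder κ Θ D
  eventually_rel : ∀ a γ, γ < Θ → a < γ → ∀ᶠ i in (U : Filter (Idx δ)), LadderRel D (w i) a γ
  lt_of_rel : ∀ i, ∀ γ < Θ, ∀ β, LadderRel D (w i) β γ → G i β < G i γ

theorem IsLadderHeights.mem_traceSet_of_lt (h : IsLadderHeights U κ Θ D w G)
    {γ γ' o : Ordinal.{0}} (hγ : γ < Θ) (hγ' : γ' < Θ)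
    (ho : o ∈ traceSet hU D w G γ') (hoγ : o < ordRank hU fun i => G i γ) :
    o ∈ traceSet hU D w G γ := by
  obtain ⟨g, rfl⟩ := exists_of_mem_traceSet hU ho
  rw [ordRank_mem_traceSet_iff] at ho ⊢
  rw [ordRank_lt_iff] at hoγ
  rcases lt_trichotomy γ' γ with hlt | rfl | hlt
  · filter_upwards [ho, h.eventually_rel γ' γ hγ hlt] with i ⟨β, hβ, hβg⟩ h2
    exact ⟨β, (h.ladder.rel_iff_of_rel hγ h2 (h.ladder.lt_of_rel hγ' hβ)).2 hβ, hβg⟩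
  · exact ho
  · filter_upwards [ho, hoγ, h.eventually_rel γ γ' hγ' hlt] with i ⟨β, hβ, hβg⟩ h2 h3
    rw [← hβg] at h2
    refine ⟨β, ?_, hβg⟩
    rcases lt_trichotomy β γ with hlt | rfl | hlt
    · exact (h.ladder.rel_iff_of_rel hγ' h3 hlt).1 hβ
    · exact absurd h2 (lt_irrefl _)
    · have hβΘ := (h.ladder.lt_of_rel hγ' hβ).trans hγ'
      exact absurd h2 (h.lt_of_rel i β hβΘ γ ((h.ladder.rel_iff_of_rel hγ' hβ hlt).1 h3)).not_gt

theorem IsLadderHeights.lt_of_mem_traceSet (h : IsLadderHeights U κ Θ D w G)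
    {γ o : Ordinal.{0}} (hγ : γ < Θ) (ho : o ∈ traceSet hU D w G γ) :
    o < ordRank hU fun i => G i γ := by
  obtain ⟨g, rfl⟩ := exists_of_mem_traceSet hU ho
  rw [ordRank_mem_traceSet_iff] at ho
  rw [ordRank_lt_iff]
  filter_upwards [ho] with i ⟨β, hβ, hβg⟩ using hβg ▸ h.lt_of_rel i γ hγ β hβ

theorem IsLadderHeights.ordRank_mem_traceSet (h : IsLadderHeights U κ Θ D w G) {γ γ' : Ordinal.{0}}
    (hγ' : γ' < Θ) (hlt : γ < γ') : (ordRank hU fun i => G i γ) ∈ traceSet hU D w G γ' := by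
  rw [ordRank_mem_traceSet_iff]
  exact (h.eventually_rel γ γ' hγ' hlt).mono fun i hi => ⟨γ, hi, rfl⟩

/-- The union of the sets `traceSet hU D w G γ` for `γ < Θ`. -/
def traceUnion (hU : IsNormalUltrafilter δ U) (Θ : Ordinal.{0}) (D : Ordinal.{0} → Set Ordinal.{0})
    (w : Idx δ → Cardinal.{1}) (G : Idx δ → Ordinal.{0} → Ordinal.{0}) : Set Ordinal.{0} :=
  { o | ∃ γ < Θ, o ∈ traceSet hU D w G γ }

theorem IsLadderHeights.mem_traceSet_of_mem_traceUnion (h : IsLadderHeights U κ Θ D w G)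
    {γ o : Ordinal.{0}} (hγ : γ < Θ) (ho : o ∈ traceUnion hU Θ D w G)
    (hoγ : o < ordRank hU fun i => G i γ) : o ∈ traceSet hU D w G γ :=
  let ⟨_, hγ', ho'⟩ := ho
  h.mem_traceSet_of_lt hU hγ hγ' ho' hoγ

theorem IsLadderHeights.unbSub_traceUnion (h : IsLadderHeights U κ Θ D w G)
    (hΘ : Order.IsSuccLimit Θ) {l : Ordinal.{0}}
    (hlt : ∀ γ < Θ, (ordRank hU fun i => G i γ) < l)
    (hcof : ∀ b < l, ∃ γ < Θ, b ≤ ordRank hU fun i => G i γ) :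
    UnbSub (traceUnion hU Θ D w G) l := by
  refine ⟨fun o ⟨γ, hγ, ho⟩ => (h.lt_of_mem_traceSet hU hγ ho).trans (hlt γ hγ), fun b hb => ?_⟩
  obtain ⟨γ, hγ, hbγ⟩ := hcof b hb
  have hγ' := hΘ.add_one_lt hγ
  exact ⟨_, ⟨γ + 1, hγ', h.ordRank_mem_traceSet hU hγ' (Order.lt_add_one_iff.2 le_rfl)⟩, hbγ⟩

theorem IsLadderHeights.inUlt_traceUnion_inter_Iio (h : IsLadderHeights U κ Θ D w G)
    {γ α : Ordinal.{0}} (hγ : γ < Θ) (hα : α ≤ ordRank hU fun i => G i γ) :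
    InUlt hU (traceUnion hU Θ D w G ∩ Iio α) := by
  have ⟨a, ha⟩ : ∃ a : Idx δ → Ordinal.{0}, ordRank hU a = α := by
    rcases hα.eq_or_lt with heq | hlt
    · exact ⟨_, heq.symm⟩
    · exact exists_ordRank_eq hU hlt
  refine ⟨fun i => G i '' { β | LadderRel D (w i) β γ } ∩ Iio (a i),
    fun i => bddAbove_Iio.mono inter_subset_right, ?_⟩
  ext o
  constructor
  · rintro ⟨ho, hoα⟩
    have hmem := h.mem_traceSet_of_mem_traceUnion hU hγ ho (lt_of_lt_of_le hoα hα)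
    obtain ⟨g, rfl⟩ := exists_of_mem_traceSet hU hmem
    rw [ordRank_mem_ultSet_iff]
    exact ((ordRank_mem_traceSet_iff hU).1 hmem).and
      ((ordRank_lt_iff hU).1 (lt_of_lt_of_eq hoα ha.symm))
  · rintro ⟨g, hg, rfl⟩
    refine ⟨⟨γ, hγ, (ordRank_mem_traceSet_iff hU).2 ?_⟩, ?_⟩
    · exact Filter.mem_of_superset hg fun i hi => hi.1
    · rw [mem_Iio, ← ha, ordRank_lt_iff]
      exact Filter.mem_of_superset hg fun i hi => hi.2

theorem IsLadderHeights.not_inUlt_traceUnion (h : IsLadderHeights U κ Θ D w G)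
    {f : Idx δ → Ordinal.{0}} (hw : ∀ᶠ i in (U : Filter (Idx δ)), ℵ₀ ≤ w i)
    (hf : ∀ᶠ i in (U : Filter (Idx δ)), Order.succ (w i) < (Ordinal.lift.{1} (f i)).cof)
    (hunb : UnbSub (traceUnion hU Θ D w G) (ordRank hU f)) :
    ¬ InUlt hU (traceUnion hU Θ D w G) := by
  rintro ⟨F, -, hF⟩
  have hlarge : ∀ᶠ i in (U : Filter (Idx δ)), ∃ x ∈ F i, w i < #↥(F i ∩ Iio (f i) ∩ Iio x) := by
    by_contra hcon
    rw [← Ultrafilter.eventually_not] at hcon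
    have hb : ∀ᶠ i in (U : Filter (Idx δ)), sSup ((· + 1) '' (F i ∩ Iio (f i))) < f i := by
      filter_upwards [hf, hcon] with i h1 h2
      push Not at h2
      refine Ordinal.sSup_add_one_lt_of_lt_cof (lt_of_le_of_lt ?_ h1) fun x hx => hx.2
      exact mk_le_of_forall_mk_inter_Iio_lt fun x hx => Order.lt_succ_iff.2 (h2 x hx.1)
    obtain ⟨o, ho, hbo⟩ := hunb.2 _ ((ordRank_lt_iff hU).2 hb)
    have hol := hunb.1 ho
    rw [hF] at ho
    obtain ⟨g, hg, rfl⟩ := ho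
    have hev := ((ordRank_le_iff hU).1 hbo).and (((ordRank_lt_iff hU).1 hol).and hg)
    obtain ⟨i, h1, h2, h3⟩ := hev.exists
    refine absurd h1 (not_le.2 (Order.add_one_le_iff.1 (le_csSup ⟨f i, ?_⟩ ⟨g i, ⟨h3, h2⟩, rfl⟩)))
    rintro _ ⟨x, hx, rfl⟩
    exact Order.add_one_le_iff.2 hx.2
  have hchoice : ∀ i, ∃ x, (∃ x ∈ F i, w i < #↥(F i ∩ Iio (f i) ∩ Iio x)) →
      x ∈ F i ∧ w i < #↥(F i ∩ Iio (f i) ∩ Iio x) := fun i =>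
    ⟨Classical.epsilon fun x => x ∈ F i ∧ w i < #↥(F i ∩ Iio (f i) ∩ Iio x),
      fun hi => Classical.epsilon_spec hi⟩
  choose x hx using hchoice
  have hxA : ordRank hU x ∈ traceUnion hU Θ D w G :=
    hF ▸ (ordRank_mem_ultSet_iff hU).2 (hlarge.mono fun i hi => (hx i hi).1)
  obtain ⟨γ, hγ, hxγ⟩ := hxA
  have hsub : ∀ᶠ i in (U : Filter (Idx δ)),
      F i ∩ Iio (f i) ∩ Iio (x i) ⊆ G i '' { β | LadderRel D (w i) β γ } := by
    by_contra hcon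
    rw [← Ultrafilter.eventually_not] at hcon
    have hchoice' : ∀ i, ∃ y, (¬ F i ∩ Iio (f i) ∩ Iio (x i) ⊆
        G i '' { β | LadderRel D (w i) β γ }) → y ∈ F i ∩ Iio (f i) ∩ Iio (x i) ∧
          y ∉ G i '' { β | LadderRel D (w i) β γ } := fun i =>
      ⟨Classical.epsilon fun y => y ∈ F i ∩ Iio (f i) ∩ Iio (x i) ∧
          y ∉ G i '' { β | LadderRel D (w i) β γ },
        fun hi => Classical.epsilon_spec (not_subset.1 hi)⟩
    choose y hy using hchoice'
    have hyA : ordRank hU y ∈ traceUnion hU Θ D w G :=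
      hF ▸ (ordRank_mem_ultSet_iff hU).2 (hcon.mono fun i hi => (hy i hi).1.1.1)
    have hyx : ordRank hU y < ordRank hU x :=
      (ordRank_lt_iff hU).2 (hcon.mono fun i hi => (hy i hi).1.2)
    have hyγ := h.mem_traceSet_of_mem_traceUnion hU hγ hyA
      (hyx.trans (h.lt_of_mem_traceSet hU hγ hxγ))
    obtain ⟨i, h1, h2⟩ := (hcon.and ((ordRank_mem_traceSet_iff hU).1 hyγ)).exists
    exact (hy i h1).2 h2
  obtain ⟨i, h1, h2, h3⟩ := (hlarge.and (hsub.and hw)).exists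
  refine absurd (hx i h1).2 (not_lt.2 ?_)
  exact (Cardinal.mk_le_mk_of_subset h2).trans
    (Cardinal.mk_image_le.trans (h.ladder.mk_setOf_rel_le h3 hγ))

theorem lub_le_of_unbSub {A : Set Ordinal.{0}} {l : Ordinal.{0}} (hA : UnbSub A l) : lub A ≤ l := by
  refine csSup_le' ?_
  rintro _ ⟨o, ho, rfl⟩
  exact Order.add_one_le_iff.2 (hA.1 ho)

end Fresh

/-- Let `κ` be a singular cardinal of cofinality `δ` with `μ^δ < κ` for all
`μ < κ`, and let `λ` be a limit ordinal with `κ⁺ < λ < j_U(κ)`, `cof(λ) = κ⁺`, that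
is a regular cardinal in `Ult(V,U)`. If there is a `□_κ`-sequence, then there is an
unbounded subset of `λ` that is fresh over `Ult(V,U)`. -/
theorem stmt18 (δ : Cardinal.{0}) (U : Ultrafilter (Idx δ)) (hU : IsNormalUltrafilter δ U)
    (κ : Cardinal.{0}) (hsing : IsSingular κ) (hcof : κ.ord.cof = δ)
    (hexp : ∀ μ : Cardinal.{0}, μ < κ → μ ^ δ < κ)
    (l : Ordinal.{0}) (hl : Order.IsSuccLimit l)
    (h1 : (Order.succ κ).ord < l) (h2 : l < jU hU κ.ord)
    (h3 : l.cof = Order.succ κ) (h4 : RegularInUlt hU l)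
    (hsq : ∃ C : Ordinal.{0} → Set Ordinal.{0}, IsSquareKappaSeq κ C) :
    ∃ A : Set Ordinal.{0}, UnbSub A l ∧ Fresh hU A := by
  obtain ⟨C, hC⟩ := hsq
  obtain ⟨f, rfl, hreg⟩ := h4
  obtain ⟨m, hm, hsucc⟩ := hU.exists_width hsing hcof hexp
  have hδκ : ℵ₀ < κ := hU.uncountable.trans (hcof ▸ hsing.2)
  have hD := hC.isCoherentLadder hsing.1
  have hΘ : Order.IsSuccLimit (Order.succ κ).ord :=
    Cardinal.isSuccLimit_ord (hsing.1.trans (Order.le_succ κ))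
  have hinf : ∀ᶠ i in (U : Filter (Idx δ)), ℵ₀ ≤ m i := (hm ℵ₀ hδκ).mono fun i hi => hi.le
  have hmf : ∀ᶠ i in (U : Filter (Idx δ)), Order.succ (m i) < (f i).cof := by
    have hle : ∀ᶠ i in (U : Filter (Idx δ)), (Order.succ (m i)).ord < f i := by
      refine (ordRank_lt_iff hU).1 (lt_of_le_of_lt (le_of_forall_lt fun o ho => ?_) h1)
      obtain ⟨g, rfl⟩ := exists_ordRank_eq hU ho
      exact hsucc g ((ordRank_lt_iff hU).1 ho)
    filter_upwards [hle, hreg] with i hi hri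
    rw [← hri.2] at hi ⊢
    rw [hri.1.cof_ord]
    exact Cardinal.ord_lt_ord.1 hi
  obtain ⟨c, hc⟩ := Ordinal.exists_isFundamentalSeq (congrArg Cardinal.ord h3)
  have hrep : ∀ γ : Ordinal.{0}, ∃ k : Idx δ → Ordinal.{0},
      ∀ hγ : γ < (Order.succ κ).ord, ordRank hU k = c ⟨γ, hγ⟩ := by
    intro γ
    by_cases hγ : γ < (Order.succ κ).ord
    · obtain ⟨k, hk⟩ := exists_ordRank_eq hU (c ⟨γ, hγ⟩).2
      exact ⟨k, fun _ => hk⟩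
    · exact ⟨0, fun hγ' => absurd hγ' hγ⟩
  choose k hk using hrep
  let w : Idx δ → Cardinal.{1} := fun i => Cardinal.lift.{1} (m i)
  let base : Idx δ → Ordinal.{0} → Ordinal.{0} := fun i γ => if k γ i < f i then k γ i else 0
  let G : Idx δ → Ordinal.{0} → Ordinal.{0} := fun i => ladderHeight (squareLadder C) (w i) (base i)
  have hw : ∀ᶠ i in (U : Filter (Idx δ)), ℵ₀ ≤ w i :=
    hinf.mono fun i hi => Cardinal.aleph0_le_lift.2 hi
  have hwf : ∀ᶠ i in (U : Filter (Idx δ)), Order.succ (w i) < (Ordinal.lift.{1} (f i)).cof := by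
    filter_upwards [hmf] with i hi
    rw [← Ordinal.lift_cof, ← Cardinal.lift_succ, Cardinal.lift_lt]
    exact hi
  have hwκ : ∀ ν < Cardinal.lift.{1} κ, ∀ᶠ i in (U : Filter (Idx δ)), ν < w i := by
    intro ν hν
    obtain ⟨ν, rfl⟩ := Cardinal.mem_range_lift_of_le hν.le
    exact (hm ν (Cardinal.lift_lt.1 hν)).mono fun i hi => Cardinal.lift_lt.2 hi
  have hG : IsLadderHeights U κ (Order.succ κ).ord (squareLadder C) w G :=
    ⟨hD, fun a γ hγ haγ => hD.eventually_rel hwκ hγ haγ,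
      fun i γ hγ β hβ => ladderHeight_lt_ladderHeight _ (hD.lt_of_rel hγ hβ) hβ⟩
  have hlt : ∀ γ < (Order.succ κ).ord, (ordRank hU fun i => G i γ) < ordRank hU f := by
    intro γ hγ
    rw [ordRank_lt_iff]
    filter_upwards [hw, hwf, hmf] with i hi1 hi2 hi3
    refine hD.ladderHeight_lt hi1 ((Order.lt_succ _).trans hi2) (fun β _ => ?_) hγ
    show (if k β i < f i then k β i else 0) < f i
    split_ifs with hif
    · exact hif
    · exact Ordinal.cof_pos.1 (zero_le.trans_lt hi3)
  have hcofinal : ∀ b < ordRank hU f, ∃ γ < (Order.succ κ).ord, b ≤ ordRank hU fun i => G i γ := by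
    intro b hb
    obtain ⟨_, ⟨γ, rfl⟩, hγ⟩ := hc.isCofinal_range ⟨b, hb⟩
    refine ⟨γ, γ.2, le_trans (show b ≤ c γ from hγ) ?_⟩
    rw [← hk γ γ.2, ordRank_le_iff]
    filter_upwards [(ordRank_lt_iff hU).1 ((hk γ γ.2).trans_lt (c γ).2)] with i hi
    exact (if_pos hi).ge.trans (base_le_ladderHeight (base i) γ.1)
  have hunb := hG.unbSub_traceUnion hU hΘ hlt hcofinal
  refine ⟨_, hunb, hG.not_inUlt_traceUnion hU hw hwf hunb, fun α hα => ?_⟩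
  obtain ⟨γ, hγ, hαγ⟩ := hcofinal α (hα.trans_le (lub_le_of_unbSub hunb))
  exact hG.inUlt_traceUnion_inter_Iio hU hγ hαγ

end MU
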